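/- arXiv:2302.14789 — 4 statements merged into one kernel-verified Lean document; each statement's English description precedes it below -/
import Mathlib

section
/- (Lax pair) Suppose the coefficients G_j(n;t) satisfy the Toda-type evolution equations: for m = −k,…,−1, dG_m(n;t)/dt = Σ_{j=−k}^{m} G_j(n;t)G_{m−j}(n+j;t) − Σ_{j=0}^{k+m} G_j(n;t)G_{m−j}(n+j;t), and for m = 0,…,k, dG_m(n;t)/dt = Σ_{j=m−k}^{−1} G_j(n;t)G_{m−j}(n+j;t) − Σ_{j=m+1}^{k} G_j(n;t)G_{m−j}(n+j;t), for all n ≥ 0 and t. Then the semi-infinite block matrices L(t) and L⁺(t) satisfy the Lax equation entrywise: for all i, j ∈ ℕ₀ and all t, d/dt L(t)_{i,j} = Σ_{s∈ℕ₀} ( L(t)_{i,s} L⁺(t)_{s,j} − L⁺(t)_{i,s} L(t)_{s,j} ), where the sum has only finitely many nonzero terms. -/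
open Matrix

/-- The semi-infinite block matrix `L(t)` with `N×N` matrix entries
`L(t)_{i,j} = G_{j-i}(i;t)`. -/
def Lmat {N : ℕ} (G : ℤ → ℤ → ℝ → Matrix (Fin N) (Fin N) ℂ) (t : ℝ) (i j : ℕ) :
    Matrix (Fin N) (Fin N) ℂ :=
  G ((j : ℤ) - (i : ℤ)) (i : ℤ) t

/-- The upper triangular part `L⁺(t)`: `L⁺(t)_{i,j} = L(t)_{i,j}` if `i ≤ j` and `0` otherwise. -/
def Lplus {N : ℕ} (G : ℤ → ℤ → ℝ → Matrix (Fin N) (Fin N) ℂ) (t : ℝ) (i j : ℕ) :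
    Matrix (Fin N) (Fin N) ℂ :=
  if i ≤ j then Lmat G t i j else 0

/-- A finite sum over a subinterval, written as a sum over the larger interval with a cutoff. -/
theorem sum_Icc_eq_sum_ite {M : Type*} [AddCommMonoid M] (P : ℤ → M) {a b c d : ℤ}
    (ha : c ≤ a) (hb : b ≤ d) :
    ∑ x ∈ Finset.Icc a b, P x = ∑ x ∈ Finset.Icc c d, if a ≤ x ∧ x ≤ b then P x else 0 := by
  rw [← Finset.sum_filter]
  congr 1
  ext x
  simp only [Finset.mem_Icc, Finset.mem_filter]
  omega

/-- A sum over `ℕ` of a shifted function on `ℤ` supported in a bounded interval to the right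
of the shift. -/
theorem finsum_natCast_sub {M : Type*} [AddCommMonoid M] (F : ℤ → M) (i : ℕ) {c d : ℤ}
    (hF : ∀ x, F x ≠ 0 → (c ≤ x ∧ x ≤ d) ∧ 0 ≤ (i : ℤ) + x) :
    (Function.support fun s : ℕ => F ((s : ℤ) - i)).Finite ∧
      ∑ᶠ s : ℕ, F ((s : ℤ) - i) = ∑ x ∈ Finset.Icc c d, F x := by
  have hinj : Function.Injective fun s : ℕ => (s : ℤ) - i := fun x y h => by
    simp only at h
    omega
  have hsub : Function.support F ⊆ ↑(Finset.Icc c d) := fun x hx => by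
    simpa using (hF x hx).1
  refine ⟨((Finset.finite_toSet _).subset hsub).preimage hinj.injOn, ?_⟩
  rw [← finsum_eq_sum_of_support_subset F hsub, ← finsum_mem_range (f := F) hinj]
  refine finsum_congr fun x => ?_
  classical
  rw [finsum_eq_if]
  split_ifs with hx
  · rfl
  · by_contra h
    exact hx ⟨(i + x).toNat, by have := (hF x (Ne.symm h)).2; simp only; omega⟩

/-- **Lax pair.** If the coefficients `G_j(n;t)` (with the vanishing conventions
`G_j(n;t) = 0` for `|j| > k`, `n < 0` or `n + j < 0`, and differentiable entries) satisfy the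
Toda-type evolution equations, then the semi-infinite block matrices `L(t)`, `L⁺(t)` satisfy the
Lax equation `dL/dt = L L⁺ - L⁺ L` entrywise, the inner sum over `s ∈ ℕ₀` having only finitely
many nonzero terms. -/
theorem lax_pair
    (N k : ℕ) (hN : 1 ≤ N) (hk : 1 ≤ k)
    (G : ℤ → ℤ → ℝ → Matrix (Fin N) (Fin N) ℂ)
    (hGzero : ∀ j n : ℤ, ∀ t : ℝ, ((k : ℤ) < |j| ∨ n < 0 ∨ n + j < 0) → G j n t = 0)
    (hGdiff : ∀ j n : ℤ, ∀ a b, Differentiable ℝ fun t => (G j n t) a b)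
    (hToda : ∀ n : ℤ, 0 ≤ n → ∀ t : ℝ, ∀ m : ℤ, ∀ a b,
      ((-(k : ℤ) ≤ m ∧ m ≤ -1) →
        HasDerivAt (fun s => (G m n s) a b)
          ((∑ j ∈ Finset.Icc (-(k : ℤ)) m, G j n t * G (m - j) (n + j) t -
            ∑ j ∈ Finset.Icc (0 : ℤ) ((k : ℤ) + m), G j n t * G (m - j) (n + j) t) a b) t) ∧
      ((0 ≤ m ∧ m ≤ (k : ℤ)) →
        HasDerivAt (fun s => (G m n s) a b)
          ((∑ j ∈ Finset.Icc (m - (k : ℤ)) (-1 : ℤ), G j n t * G (m - j) (n + j) t -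
            ∑ j ∈ Finset.Icc (m + 1) (k : ℤ), G j n t * G (m - j) (n + j) t) a b) t)) :
    ∀ i j : ℕ, ∀ t : ℝ,
      (Function.support fun s : ℕ =>
        Lmat G t i s * Lplus G t s j - Lplus G t i s * Lmat G t s j).Finite ∧
      ∀ a b, HasDerivAt (fun s => (Lmat G s i j) a b)
        ((∑ᶠ s : ℕ, (Lmat G t i s * Lplus G t s j - Lplus G t i s * Lmat G t s j)) a b) t := by
  intro i j t
  obtain ⟨m, hm⟩ : ∃ m : ℤ, m = (j : ℤ) - i := ⟨_, rfl⟩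
  set P : ℤ → Matrix (Fin N) (Fin N) ℂ := fun x => G x i t * G (m - x) (i + x) t with hP
  set F : ℤ → Matrix (Fin N) (Fin N) ℂ := fun x =>
    (if x ≤ m then P x else 0) - (if 0 ≤ x then P x else 0) with hF
  have hP0 : ∀ x, ((k : ℤ) < |x| ∨ (k : ℤ) < |m - x| ∨ (i : ℤ) + x < 0) → P x = 0 := by
    rintro x (h | h | h)
    · simp [hP, hGzero x i t (Or.inl h)]
    · simp [hP, hGzero (m - x) (i + x) t (Or.inl h)]
    · simp [hP, hGzero x i t (Or.inr (Or.inr h))]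
  have hterm : (fun s : ℕ => Lmat G t i s * Lplus G t s j - Lplus G t i s * Lmat G t s j) =
      fun s : ℕ => F ((s : ℤ) - i) := by
    funext s
    have h1 : m - ((s : ℤ) - i) = j - s := by omega
    have h2 : (i : ℤ) + (s - i) = s := by omega
    have h3 : (s : ℤ) - i ≤ m ↔ s ≤ j := by omega
    have h4 : (0 : ℤ) ≤ s - i ↔ i ≤ s := by omega
    simp only [hF, hP, Lplus, Lmat, h1, h2, h3, h4, mul_ite, ite_mul, mul_zero, zero_mul]
  have hFsupp : ∀ x, F x ≠ 0 → (-(k : ℤ) ≤ x ∧ x ≤ k) ∧ 0 ≤ (i : ℤ) + x := by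
    intro x hx
    have hPx : P x ≠ 0 := fun h => hx (by simp [hF, h])
    have h := mt (hP0 x) hPx
    push Not at h
    exact ⟨abs_le.mp h.1, h.2.2⟩
  obtain ⟨hfin, hsum⟩ := finsum_natCast_sub F i hFsupp
  rw [hterm, hsum]
  refine ⟨hfin, fun a b => ?_⟩
  simp only [Lmat, ← hm]
  rcases lt_or_ge (k : ℤ) |m| with hmk | hmk
  · have h0 : ∑ x ∈ Finset.Icc (-(k : ℤ)) k, F x = 0 := by
      refine Finset.sum_eq_zero fun x hx => ?_
      rw [Finset.mem_Icc] at hx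
      have hPx : x ≤ m ∧ x < 0 ∨ m < x ∧ 0 ≤ x → P x = 0 := fun h =>
        hP0 x (by simp only [lt_abs] at hmk ⊢; omega)
      simp only [hF]
      by_cases hx0 : P x = 0
      · simp [hx0]
      · have hx1 := mt hPx hx0
        split_ifs <;> first | omega | simp
    simpa [h0, hGzero m i _ (Or.inl hmk)] using hasDerivAt_const t (0 : ℂ)
  · have hmk' := abs_le.mp hmk
    rcases lt_or_ge m 0 with hneg | hpos
    · have hF_sum : ∑ x ∈ Finset.Icc (-(k : ℤ)) k, F x = ∑ x ∈ Finset.Icc (-(k : ℤ)) m, P x -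
          ∑ x ∈ Finset.Icc 0 (k + m), P x := by
        rw [sum_Icc_eq_sum_ite P (c := -(k : ℤ)) (d := k) le_rfl hmk'.2,
          sum_Icc_eq_sum_ite P (c := -(k : ℤ)) (d := k) (by omega) (by omega),
          ← Finset.sum_sub_distrib]
        refine Finset.sum_congr rfl fun x hx => ?_
        rw [Finset.mem_Icc] at hx
        have hPx : k + m < x → P x = 0 := fun h => hP0 x (by simp only [lt_abs]; omega)
        simp only [hF]
        by_cases hx0 : P x = 0
        · simp [hx0]
        · have hx1 := mt hPx hx0
          split_ifs <;> first | omega | simp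
      rw [hF_sum]
      exact (hToda i (by omega) t m a b).1 ⟨hmk'.1, by omega⟩
    · have hF_sum : ∑ x ∈ Finset.Icc (-(k : ℤ)) k, F x = ∑ x ∈ Finset.Icc (m - k) (-1), P x -
          ∑ x ∈ Finset.Icc (m + 1) k, P x := by
        rw [sum_Icc_eq_sum_ite P (c := -(k : ℤ)) (d := k) (by omega) (by omega),
          sum_Icc_eq_sum_ite P (c := -(k : ℤ)) (d := k) (by omega) le_rfl,
          ← Finset.sum_sub_distrib]
        refine Finset.sum_congr rfl fun x hx => ?_
        rw [Finset.mem_Icc] at hx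
        have hPx : x < m - k → P x = 0 := fun h => hP0 x (by simp only [lt_abs]; omega)
        simp only [hF]
        by_cases hx0 : P x = 0
        · simp [hx0]
        · have hx1 := mt hPx hx0
          split_ifs <;> first | omega | simp
      rw [hF_sum]
      exact (hToda i (by omega) t m a b).2 ⟨hpos, hmk'.2⟩
end

section
/- (Time evolution of the orthogonal polynomials, Lemma 12) In the stated setting, for every n ≥ 0 and every t, the t-derivative of the monic orthogonal polynomial P_n is given by ∂P_n/∂t(x;t) = Σ_{m=0}^{n−1} V_{m−n}(n;t) P_m(x;t). -/
open Matrix MeasureTheory Polynomial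
open scoped ComplexOrder

/-- Evaluation of a matrix polynomial at a real point: `p(x) = Σ pᵢ xⁱ`. -/
noncomputable def mEval {N : ℕ} (p : Polynomial (Matrix (Fin N) (Fin N) ℂ)) (x : ℝ) :
    Matrix (Fin N) (Fin N) ℂ :=
  p.eval ((x : ℂ) • (1 : Matrix (Fin N) (Fin N) ℂ))

/-- Entrywise integral of a matrix valued function. -/
noncomputable def mInt {N : ℕ} (μ : Measure ℝ) (f : ℝ → Matrix (Fin N) (Fin N) ℂ) :
    Matrix (Fin N) (Fin N) ℂ :=
  Matrix.of fun i j => ∫ x, f x i j ∂μ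

theorem mEval_zero {N : ℕ} (x : ℝ) :
    mEval (0 : Polynomial (Matrix (Fin N) (Fin N) ℂ)) x = 0 := by
  simp [mEval]

theorem mEval_add {N : ℕ} (p q : Polynomial (Matrix (Fin N) (Fin N) ℂ)) (x : ℝ) :
    mEval (p + q) x = mEval p x + mEval q x := by
  simp [mEval]

theorem mEval_sub {N : ℕ} (p q : Polynomial (Matrix (Fin N) (Fin N) ℂ)) (x : ℝ) :
    mEval (p - q) x = mEval p x - mEval q x := by
  simp [mEval]

theorem mEval_C_mul {N : ℕ} (a : Matrix (Fin N) (Fin N) ℂ)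
    (p : Polynomial (Matrix (Fin N) (Fin N) ℂ)) (x : ℝ) :
    mEval (C a * p) x = a * mEval p x := by
  simp [mEval]

theorem mEval_sum {N : ℕ} {ι : Type*} (s : Finset ι)
    (p : ι → Polynomial (Matrix (Fin N) (Fin N) ℂ)) (x : ℝ) :
    mEval (∑ l ∈ s, p l) x = ∑ l ∈ s, mEval (p l) x := by
  simp [mEval, eval_finsetSum]

theorem mEval_monomial {N : ℕ} (d : ℕ) (a : Matrix (Fin N) (Fin N) ℂ) (x : ℝ) :
    mEval (monomial d a) x = ((x : ℂ) ^ d) • a := by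
  rw [mEval, eval_monomial, _root_.smul_pow, one_pow, mul_smul_comm, mul_one]

/-- Pointwise conjugate transposes of matrix polynomials are matrix polynomials. -/
theorem exists_mEval_eq_conjTranspose {N : ℕ} (q : Polynomial (Matrix (Fin N) (Fin N) ℂ)) :
    ∃ q' : Polynomial (Matrix (Fin N) (Fin N) ℂ), ∀ x, mEval q' x = (mEval q x)ᴴ := by
  induction q using Polynomial.induction_on' with
  | add p q hp hq =>
    obtain ⟨p', hp⟩ := hp
    obtain ⟨q', hq⟩ := hq
    exact ⟨p' + q', fun x => by simp [mEval_add, hp, hq]⟩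
  | monomial d a =>
    refine ⟨monomial d aᴴ, fun x => ?_⟩
    simp [mEval_monomial, conjTranspose_smul]

/-- A matrix polynomial whose coefficients from `n` on vanish, evaluated coefficientwise. -/
theorem mEval_eq_sum_range {N : ℕ} (p : Polynomial (Matrix (Fin N) (Fin N) ℂ)) (n : ℕ)
    (hp : ∀ d, n ≤ d → p.coeff d = 0) (x : ℝ) :
    mEval p x = ∑ d ∈ Finset.range n, ((x : ℂ) ^ d) • p.coeff d := by
  have h : p = ∑ d ∈ Finset.range n, monomial d (p.coeff d) := by
    ext1 d
    simp only [finsetSum_coeff, coeff_monomial, Finset.sum_ite_eq', Finset.mem_range]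
    split_ifs with hd
    · rfl
    · exact hp d (not_lt.mp hd)
  conv_lhs => rw [h]
  simp only [mEval_sum, mEval_monomial]

/-- The matrix valued inner product of two matrix polynomials for the weight `H`. -/
noncomputable def matInner {N : ℕ} (μ : Measure ℝ) (H : ℝ → Matrix (Fin N) (Fin N) ℂ)
    (p q : Polynomial (Matrix (Fin N) (Fin N) ℂ)) : Matrix (Fin N) (Fin N) ℂ :=
  mInt μ fun x => mEval p x * H x * (mEval q x)ᴴ

section Inner

variable {N : ℕ} {μ : Measure ℝ} {H : ℝ → Matrix (Fin N) (Fin N) ℂ}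

theorem integrable_mEval_mul_conjTranspose
    (hInt : ∀ p q : Polynomial (Matrix (Fin N) (Fin N) ℂ), ∀ i j,
      Integrable (fun x => (mEval p x * H x * mEval q x) i j) μ)
    (p q : Polynomial (Matrix (Fin N) (Fin N) ℂ)) (i j : Fin N) :
    Integrable (fun x => (mEval p x * H x * (mEval q x)ᴴ) i j) μ := by
  obtain ⟨q', hq⟩ := exists_mEval_eq_conjTranspose q
  simpa only [hq] using hInt p q' i j

theorem matInner_zero_left (q : Polynomial (Matrix (Fin N) (Fin N) ℂ)) :
    matInner μ H 0 q = 0 := by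
  ext i j
  simp [matInner, mInt, mEval_zero]

theorem matInner_zero_right (p : Polynomial (Matrix (Fin N) (Fin N) ℂ)) :
    matInner μ H p 0 = 0 := by
  ext i j
  simp [matInner, mInt, mEval_zero]

theorem matInner_add_left
    (hInt : ∀ p q : Polynomial (Matrix (Fin N) (Fin N) ℂ), ∀ i j,
      Integrable (fun x => (mEval p x * H x * mEval q x) i j) μ)
    (p p' q : Polynomial (Matrix (Fin N) (Fin N) ℂ)) :
    matInner μ H (p + p') q = matInner μ H p q + matInner μ H p' q := by
  ext i j
  simp only [matInner, mInt, of_apply, mEval_add, add_mul, Matrix.add_apply]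
  exact integral_add (integrable_mEval_mul_conjTranspose hInt p q i j)
    (integrable_mEval_mul_conjTranspose hInt p' q i j)

theorem matInner_sub_left
    (hInt : ∀ p q : Polynomial (Matrix (Fin N) (Fin N) ℂ), ∀ i j,
      Integrable (fun x => (mEval p x * H x * mEval q x) i j) μ)
    (p p' q : Polynomial (Matrix (Fin N) (Fin N) ℂ)) :
    matInner μ H (p - p') q = matInner μ H p q - matInner μ H p' q := by
  ext i j
  simp only [matInner, mInt, of_apply, mEval_sub, sub_mul, Matrix.sub_apply]
  exact integral_sub (integrable_mEval_mul_conjTranspose hInt p q i j)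
    (integrable_mEval_mul_conjTranspose hInt p' q i j)

theorem matInner_add_right
    (hInt : ∀ p q : Polynomial (Matrix (Fin N) (Fin N) ℂ), ∀ i j,
      Integrable (fun x => (mEval p x * H x * mEval q x) i j) μ)
    (p q q' : Polynomial (Matrix (Fin N) (Fin N) ℂ)) :
    matInner μ H p (q + q') = matInner μ H p q + matInner μ H p q' := by
  ext i j
  simp only [matInner, mInt, of_apply, mEval_add, conjTranspose_add, mul_add, Matrix.add_apply]
  exact integral_add (integrable_mEval_mul_conjTranspose hInt p q i j)
    (integrable_mEval_mul_conjTranspose hInt p q' i j)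

theorem matInner_C_mul_left
    (hInt : ∀ p q : Polynomial (Matrix (Fin N) (Fin N) ℂ), ∀ i j,
      Integrable (fun x => (mEval p x * H x * mEval q x) i j) μ)
    (a : Matrix (Fin N) (Fin N) ℂ) (p q : Polynomial (Matrix (Fin N) (Fin N) ℂ)) :
    matInner μ H (C a * p) q = a * matInner μ H p q := by
  ext i j
  simp only [matInner, mInt, of_apply, mEval_C_mul, Matrix.mul_assoc]
  simp only [← Matrix.mul_assoc (mEval p _)]
  rw [Matrix.mul_apply]
  simp only [Matrix.mul_apply (M := a), of_apply]
  rw [integral_finsetSum _ fun l _ =>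
    (integrable_mEval_mul_conjTranspose hInt p q l j).const_mul (a i l)]
  simp only [integral_const_mul]

theorem matInner_C_mul_right
    (hInt : ∀ p q : Polynomial (Matrix (Fin N) (Fin N) ℂ), ∀ i j,
      Integrable (fun x => (mEval p x * H x * mEval q x) i j) μ)
    (a : Matrix (Fin N) (Fin N) ℂ) (p q : Polynomial (Matrix (Fin N) (Fin N) ℂ)) :
    matInner μ H p (C a * q) = matInner μ H p q * aᴴ := by
  ext i j
  simp only [matInner, mInt, of_apply, mEval_C_mul, conjTranspose_mul, ← Matrix.mul_assoc]
  rw [Matrix.mul_apply]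
  simp only [Matrix.mul_apply (N := aᴴ), of_apply]
  rw [integral_finsetSum _ fun l _ =>
    (integrable_mEval_mul_conjTranspose hInt p q i l).mul_const (aᴴ l j)]
  simp only [integral_mul_const]

theorem matInner_sum_left
    (hInt : ∀ p q : Polynomial (Matrix (Fin N) (Fin N) ℂ), ∀ i j,
      Integrable (fun x => (mEval p x * H x * mEval q x) i j) μ)
    {ι : Type*} (s : Finset ι) (c : ι → Matrix (Fin N) (Fin N) ℂ)
    (p : ι → Polynomial (Matrix (Fin N) (Fin N) ℂ))
    (q : Polynomial (Matrix (Fin N) (Fin N) ℂ)) :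
    matInner μ H (∑ l ∈ s, C (c l) * p l) q = ∑ l ∈ s, c l * matInner μ H (p l) q := by
  classical
  induction s using Finset.induction_on with
  | empty => simp [matInner_zero_left]
  | insert l s hl ih =>
    rw [Finset.sum_insert hl, Finset.sum_insert hl, matInner_add_left hInt,
      matInner_C_mul_left hInt, ih]

theorem matInner_sum_right
    (hInt : ∀ p q : Polynomial (Matrix (Fin N) (Fin N) ℂ), ∀ i j,
      Integrable (fun x => (mEval p x * H x * mEval q x) i j) μ)
    {ι : Type*} (s : Finset ι) (c : ι → Matrix (Fin N) (Fin N) ℂ)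
    (q : ι → Polynomial (Matrix (Fin N) (Fin N) ℂ))
    (p : Polynomial (Matrix (Fin N) (Fin N) ℂ)) :
    matInner μ H p (∑ l ∈ s, C (c l) * q l) = ∑ l ∈ s, matInner μ H p (q l) * (c l)ᴴ := by
  classical
  induction s using Finset.induction_on with
  | empty => simp [matInner_zero_right]
  | insert l s hl ih =>
    rw [Finset.sum_insert hl, Finset.sum_insert hl, matInner_add_right hInt,
      matInner_C_mul_right hInt, ih]

end Inner

/-- Over any ring, monic polynomials of each degree span on the left. -/
theorem exists_eq_sum_C_mul_of_monic {A : Type*} [Ring A] (P : ℕ → Polynomial A)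
    (hP : ∀ l, (P l).Monic) (hdeg : ∀ l, (P l).natDegree = l) (n : ℕ) (p : Polynomial A)
    (hp : ∀ d, n ≤ d → p.coeff d = 0) :
    ∃ c : ℕ → A, p = ∑ l ∈ Finset.range n, C (c l) * P l := by
  induction n generalizing p with
  | zero => exact ⟨0, by ext d; simpa using hp d d.zero_le⟩
  | succ n ih =>
    obtain ⟨c, hc⟩ := ih (p - C (p.coeff n) * P n) fun d hd => by
      rcases hd.eq_or_lt with rfl | hd
      · have h : (P n).coeff n = 1 := by simpa [hdeg n] using (hP n).coeff_natDegree
        simp [h]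
      · have h : (P n).coeff d = 0 := coeff_eq_zero_of_natDegree_lt (by rwa [hdeg n])
        simp [h, hp d hd]
    refine ⟨Function.update c n (p.coeff n), ?_⟩
    rw [Finset.sum_range_succ, Function.update_self, ← sub_eq_iff_eq_add, hc]
    refine Finset.sum_congr rfl fun l hl => ?_
    rw [Function.update_of_ne (Finset.mem_range.mp hl).ne]

/-- Entrywise product rule for matrix valued functions. -/
theorem hasDerivAt_matrix_mul_apply {N : ℕ} {A B : ℝ → Matrix (Fin N) (Fin N) ℂ}
    {A' B' : Matrix (Fin N) (Fin N) ℂ} {t : ℝ}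
    (hA : ∀ i j, HasDerivAt (fun s => A s i j) (A' i j) t)
    (hB : ∀ i j, HasDerivAt (fun s => B s i j) (B' i j) t) (i j : Fin N) :
    HasDerivAt (fun s => (A s * B s) i j) ((A' * B t + A t * B') i j) t := by
  simp only [Matrix.add_apply, Matrix.mul_apply, ← Finset.sum_add_distrib]
  exact HasDerivAt.fun_sum fun l _ => (hA i l).mul (hB l j)

/-- If the coefficients of a family of monic polynomials of degree `n` are differentiable, the
`t`-derivative of the family is a polynomial of degree `< n`. -/
theorem exists_hasDerivAt_mEval_of_monic {N : ℕ} {I : Set ℝ} (hI : IsOpen I)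
    (P : ℝ → Polynomial (Matrix (Fin N) (Fin N) ℂ)) (n : ℕ)
    (hP : ∀ t ∈ I, (P t).Monic ∧ (P t).natDegree = n)
    (hdiff : ∀ d : ℕ, ∀ i j, DifferentiableOn ℝ (fun t => ((P t).coeff d) i j) I)
    {t : ℝ} (ht : t ∈ I) :
    ∃ D : Polynomial (Matrix (Fin N) (Fin N) ℂ), (∀ d, n ≤ d → D.coeff d = 0) ∧
      ∀ x i j, HasDerivAt (fun s => mEval (P s) x i j) (mEval D x i j) t := by
  refine ⟨∑ d ∈ Finset.range n,
    monomial d (Matrix.of fun i j => deriv (fun s => ((P s).coeff d) i j) t), fun d hd => ?_,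
    fun x i j => ?_⟩
  · simp only [finsetSum_coeff, coeff_monomial, Finset.sum_ite_eq', Finset.mem_range,
      if_neg (not_lt.mpr hd)]
  · have hloc : (fun s => mEval (P s) x i j) =ᶠ[nhds t] fun s =>
        ∑ d ∈ Finset.range n, (x : ℂ) ^ d * ((P s).coeff d) i j +
          (((x : ℂ) ^ n) • (1 : Matrix (Fin N) (Fin N) ℂ)) i j := by
      filter_upwards [hI.mem_nhds ht] with s hs
      obtain ⟨hmon, hdeg⟩ := hP s hs
      have hlead : (P s).coeff n = 1 := by simpa [hdeg] using hmon.coeff_natDegree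
      rw [mEval_eq_sum_range (P s) (n + 1)
        (fun d hd => coeff_eq_zero_of_natDegree_lt (by omega)) x, Finset.sum_range_succ, hlead]
      simp [Matrix.add_apply, Matrix.sum_apply]
    refine HasDerivAt.congr_of_eventuallyEq ?_ hloc
    simp only [mEval_sum, mEval_monomial, Matrix.sum_apply, Matrix.smul_apply, smul_eq_mul,
      of_apply]
    refine HasDerivAt.add_const _ (HasDerivAt.fun_sum fun d _ => ?_)
    exact ((hdiff d i j).differentiableAt (hI.mem_nhds ht)).hasDerivAt.const_mul _

/-- **Time evolution of the orthogonal polynomials (Lemma 12).**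
`Hw t x` is a measurable, μ-a.e. Hermitian positive definite weight for `t` in an open interval
`I`, and `R t` is a matrix polynomial of degree `≤ k` with `R(x;t)H(x;t) = H(x;t)R(x;t)*` and
`∂H/∂t(x;t) = -R(x;t)H(x;t)` (μ-a.e., all `t ∈ I`); `P n t` are the monic matrix orthogonal
polynomials of degree `n` for `Hw t` with invertible norm matrices (`P m = 0` for `m < 0`);
the matrices `V j n t` realize `P_n(x;t)R(x;t) = Σ_{j=-k}^{k} V_j(n;t)P_{n+j}(x;t)` with the
vanishing conventions; the coefficients of `P n` are differentiable in `t` and differentiation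
under the integral is valid.  Then
`∂P_n/∂t(x;t) = Σ_{m=0}^{n-1} V_{m-n}(n;t) P_m(x;t)`. -/
theorem time_evolution_of_MVOPs
    (N k : ℕ) (hN : 1 ≤ N) (hk : 1 ≤ k)
    (μ : Measure ℝ)
    (I : Set ℝ) (hI : IsOpen I)
    (Hw : ℝ → ℝ → Matrix (Fin N) (Fin N) ℂ)
    (hHwmeas : ∀ t ∈ I, ∀ i j, Measurable fun x => Hw t x i j)
    (hHwpos : ∀ t ∈ I, ∀ᵐ x ∂μ, (Hw t x).PosDef)
    (R : ℝ → Polynomial (Matrix (Fin N) (Fin N) ℂ))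
    (hRdeg : ∀ t ∈ I, (R t).natDegree ≤ k)
    (hRsym : ∀ t ∈ I, ∀ᵐ x ∂μ, mEval (R t) x * Hw t x = Hw t x * (mEval (R t) x)ᴴ)
    (hHevol : ∀ t ∈ I, ∀ᵐ x ∂μ, ∀ i j,
      HasDerivAt (fun s => Hw s x i j) ((-(mEval (R t) x * Hw t x)) i j) t)
    (hInt : ∀ t ∈ I, ∀ p q : Polynomial (Matrix (Fin N) (Fin N) ℂ), ∀ i j,
      Integrable (fun x => (mEval p x * Hw t x * mEval q x) i j) μ)
    (P : ℤ → ℝ → Polynomial (Matrix (Fin N) (Fin N) ℂ))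
    (hPneg : ∀ m : ℤ, m < 0 → ∀ t, P m t = 0)
    (hPmonic : ∀ n : ℤ, 0 ≤ n → ∀ t ∈ I, (P n t).Monic ∧ (P n t).natDegree = n.toNat)
    (Hn : ℤ → ℝ → Matrix (Fin N) (Fin N) ℂ)
    (hHninv : ∀ n : ℤ, 0 ≤ n → ∀ t ∈ I, IsUnit (Hn n t))
    (hOrth : ∀ n m : ℤ, 0 ≤ n → 0 ≤ m → ∀ t ∈ I,
      mInt μ (fun x => mEval (P n t) x * Hw t x * (mEval (P m t) x)ᴴ) =
        if n = m then Hn n t else 0)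
    (V : ℤ → ℤ → ℝ → Matrix (Fin N) (Fin N) ℂ)
    (hVzero : ∀ j n : ℤ, ∀ t : ℝ, ((k : ℤ) < |j| ∨ n + j < 0) → V j n t = 0)
    (hVrel : ∀ n : ℤ, 0 ≤ n → ∀ t ∈ I, ∀ x,
      mEval (P n t) x * mEval (R t) x =
        ∑ j ∈ Finset.Icc (-(k : ℤ)) (k : ℤ), V j n t * mEval (P (n + j) t) x)
    -- regularity assumptions
    (hPdiff : ∀ n : ℤ, ∀ d : ℕ, ∀ i j, DifferentiableOn ℝ (fun t => ((P n t).coeff d) i j) I)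
    (hDUI : ∀ n m : ℤ, 0 ≤ n → 0 ≤ m → ∀ t ∈ I, ∀ i j,
      HasDerivAt
        (fun s => ∫ x, (mEval (P n s) x * Hw s x * (mEval (P m s) x)ᴴ) i j ∂μ)
        (∫ x, deriv (fun s => (mEval (P n s) x * Hw s x * (mEval (P m s) x)ᴴ) i j) t ∂μ)
        t) :
    ∀ n : ℤ, 0 ≤ n → ∀ t ∈ I, ∀ x : ℝ, ∀ i j,
      HasDerivAt (fun s => (mEval (P n s) x) i j)
        ((∑ m ∈ Finset.range n.toNat, V ((m : ℤ) - n) n t * mEval (P (m : ℤ) t) x) i j) t := by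
  intro n hn t ht x i j
  lift n to ℕ using hn
  rw [Int.toNat_natCast]
  have hPm : ∀ l : ℕ, ∀ s ∈ I, (P l s).Monic ∧ (P l s).natDegree = l := fun l s hs => by
    simpa using hPmonic l (by positivity) s hs
  have hint := hInt t ht
  have horth : ∀ a b : ℕ, matInner μ (Hw t) (P a t) (P b t) = if a = b then Hn a t else 0 :=
    fun a b => by simpa [matInner] using hOrth a b (by positivity) (by positivity) t ht
  have hspan : ∀ (m : ℕ) (p : Polynomial (Matrix (Fin N) (Fin N) ℂ)),
      (∀ d, m ≤ d → p.coeff d = 0) →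
      ∃ c : ℕ → Matrix (Fin N) (Fin N) ℂ, p = ∑ l ∈ Finset.range m, C (c l) * P l t :=
    exists_eq_sum_C_mul_of_monic (fun l : ℕ => P l t) (fun l => (hPm l t ht).1)
      fun l => (hPm l t ht).2
  have hinner_sum : ∀ (c : ℕ → Matrix (Fin N) (Fin N) ℂ) (m : ℕ), m < n →
      matInner μ (Hw t) (∑ l ∈ Finset.range n, C (c l) * P l t) (P m t) = c m * Hn m t := by
    intro c m hm
    rw [matInner_sum_left hint]
    simp [horth, hm]
  obtain ⟨D, hD, hDder⟩ :=
    exists_hasDerivAt_mEval_of_monic hI (P n) n (hPm n) (hPdiff n) ht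
  obtain ⟨c, hc⟩ := hspan n D hD
  have key : ∀ m < n, matInner μ (Hw t) D (P m t) = V ((m : ℤ) - n) n t * Hn m t := by
    intro m hm
    obtain ⟨E, hE, hEder⟩ :=
      exists_hasDerivAt_mEval_of_monic hI (P m) m (hPm m) (hPdiff m) ht
    obtain ⟨e, he⟩ := hspan m E hE
    have hPE : matInner μ (Hw t) (P n t) E = 0 := by
      rw [he, matInner_sum_right hint]
      refine Finset.sum_eq_zero fun l hl => ?_
      have := Finset.mem_range.mp hl
      rw [horth, if_neg (by omega), zero_mul]
    set Q : Polynomial (Matrix (Fin N) (Fin N) ℂ) :=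
      ∑ j ∈ Finset.Icc (-(k : ℤ)) (k : ℤ), C (V j n t) * P (n + j) t with hQ
    have hQeval : ∀ x, mEval (P n t) x * mEval (R t) x = mEval Q x := fun x => by
      rw [hVrel n (by positivity) t ht x, hQ, mEval_sum]
      simp only [mEval_C_mul]
    have hQm : matInner μ (Hw t) Q (P m t) = V ((m : ℤ) - n) n t * Hn m t := by
      have hterm : ∀ j : ℤ, matInner μ (Hw t) (P (n + j) t) (P m t) =
          if j = (m : ℤ) - n then Hn m t else 0 := by
        intro j
        rcases lt_or_ge ((n : ℤ) + j) 0 with h | h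
        · rw [hPneg _ h, matInner_zero_left, if_neg (by omega)]
        · obtain ⟨a, ha⟩ := Int.eq_ofNat_of_zero_le h
          rw [ha, horth]
          by_cases ham : a = m
          · rw [if_pos ham, if_pos (by omega), ham]
          · rw [if_neg ham, if_neg (by omega)]
      rw [hQ, matInner_sum_left hint]
      simp only [hterm, mul_ite, mul_zero, Finset.sum_ite_eq', Finset.mem_Icc]
      split_ifs with hk'
      · rfl
      · rw [hVzero _ _ _ (Or.inl _), zero_mul]
        rw [← not_le, abs_le]
        exact hk'
    have hzero : matInner μ (Hw t) (D - Q) (P m t) + matInner μ (Hw t) (P n t) E = 0 := by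
      ext i j
      have hconst : HasDerivAt
          (fun s => ∫ x, (mEval (P n s) x * Hw s x * (mEval (P m s) x)ᴴ) i j ∂μ) 0 t := by
        refine (hasDerivAt_const t (0 : ℂ)).congr_of_eventuallyEq ?_
        filter_upwards [hI.mem_nhds ht] with s hs
        have h := congrFun (congrFun (hOrth n m (by positivity) (by positivity) s hs) i) j
        rw [if_neg (by omega)] at h
        exact h
      rw [Matrix.zero_apply, ← (hDUI n m (by positivity) (by positivity) t ht i j).unique hconst]
      simp only [matInner, mInt, Matrix.add_apply, of_apply]
      rw [← integral_add (integrable_mEval_mul_conjTranspose hint _ _ i j)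
        (integrable_mEval_mul_conjTranspose hint _ _ i j)]
      refine integral_congr_ae ?_
      filter_upwards [hHevol t ht] with x hx
      have hstar : ∀ i j, HasDerivAt (fun s => (mEval (P m s) x)ᴴ i j) ((mEval E x)ᴴ i j) t :=
        fun i j => (hEder x j i).star
      rw [(hasDerivAt_matrix_mul_apply (hasDerivAt_matrix_mul_apply (hDder x) hx) hstar
        i j).deriv, ← Matrix.add_apply, mEval_sub, ← hQeval]
      refine congrFun (congrFun ?_ i) j
      noncomm_ring
    rw [hPE, add_zero, matInner_sub_left hint, sub_eq_zero] at hzero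
    rw [hzero, hQm]
  have hcV : ∀ m < n, c m = V ((m : ℤ) - n) n t := fun m hm => by
    have h := key m hm
    rw [hc, hinner_sum c m hm] at h
    exact (hHninv m (by positivity) t ht).mul_right_cancel h
  have hsum : ∑ m ∈ Finset.range n, V ((m : ℤ) - n) n t * mEval (P (m : ℤ) t) x = mEval D x := by
    rw [hc, mEval_sum]
    refine Finset.sum_congr rfl fun m hm => ?_
    rw [mEval_C_mul, hcV m (Finset.mem_range.mp hm)]
  rw [hsum]
  exact hDder x i j
end

section
/- (Langmuir-type lattice equations) In the stated setting, suppose in addition that V_{−1}(n;t) = K_0(n;t)K_{−1}(n;t) + K_{−1}(n;t)K_0(n−1;t) and V_{−2}(n;t) = K_{−1}(n;t)K_{−1}(n−1;t) for all n, t (the coefficients of the square of the three-term difference operator, corresponding to the deformation v(x;t) = tx²). Then for every n ≥ 0 and every t: dK_0(n;t)/dt = (K_0(n;t)K_{−1}(n;t) + K_{−1}(n;t)K_0(n−1;t))K_1(n−1;t) − K_1(n;t)(K_0(n+1;t)K_{−1}(n+1;t) + K_{−1}(n+1;t)K_0(n;t)), and dK_{−1}(n;t)/dt = K_{−1}(n;t)K_{−1}(n−1;t)K_1(n−2;t)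 − K_1(n;t)K_{−1}(n+1;t)K_{−1}(n;t) + K_{−1}(n;t)K_0(n−1;t)² − K_0(n;t)²K_{−1}(n;t) (terms with out-of-range indices vanish by the stated conventions). -/
open Matrix Polynomial

namespace LangmuirLattice

section Algebra

variable {R : Type*} [Ring R]

/-- A left multiple of a monic polynomial of degree `d` cancels against terms of degree `< d`
only if the multiplier vanishes. -/
lemma smul_monic_add_eq_zero {p r : R[X]} {d : ℕ} {c : R} (hp : p.Monic)
    (hd : p.natDegree = d) (hr : r ∈ degreeLT R d) (h : c • p + r = 0) : c = 0 := by
  have hc := congrArg (fun q : R[X] => q.coeff d) h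
  have hr' : r.coeff d = 0 := coeff_eq_zero_of_degree_lt (mem_degreeLT.1 hr)
  have hpd : p.coeff d = 1 := by rw [← hd]; exact hp
  simpa [hr', hpd] using hc

variable {p : ℤ → R[X]}

lemma mem_degreeLT_of_lt (hneg : ∀ m < 0, p m = 0)
    (hmonic : ∀ m, 0 ≤ m → (p m).Monic ∧ (p m).natDegree = m.toNat)
    {m k : ℤ} (h : m < k) : p m ∈ degreeLT R k.toNat := by
  rcases lt_or_ge m 0 with hm | hm
  · rw [hneg m hm]; exact Submodule.zero_mem _
  · refine mem_degreeLT.2 (degree_le_natDegree.trans_lt ?_)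
    rw [(hmonic m hm).2]
    exact_mod_cast (by omega : m.toNat < k.toNat)

lemma eq_zero_of_three_term_combination (hneg : ∀ m < 0, p m = 0)
    (hmonic : ∀ m, 0 ≤ m → (p m).Monic ∧ (p m).natDegree = m.toNat)
    {n : ℤ} (hn : 0 ≤ n) {α β γ : R} {r : R[X]} (hr : r ∈ degreeLT R (n - 1).toNat)
    (h : α • p (n + 1) + β • p n + γ • p (n - 1) + r = 0) :
    β = 0 ∧ (1 ≤ n → γ = 0) := by
  have low {m k : ℤ} (hmk : m < k) := mem_degreeLT_of_lt hneg hmonic hmk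
  have mono {j k : ℤ} (hjk : j ≤ k) : degreeLT R j.toNat ≤ degreeLT R k.toNat :=
    degreeLT_mono (Int.toNat_le_toNat hjk)
  have hα : α = 0 := by
    refine smul_monic_add_eq_zero (hmonic (n + 1) (by omega)).1 (hmonic (n + 1) (by omega)).2
      (r := β • p n + γ • p (n - 1) + r) ?_ (by rw [← h]; abel)
    exact add_mem (add_mem (Submodule.smul_mem _ _ (low (by omega)))
      (Submodule.smul_mem _ _ (low (by omega)))) (mono (by omega) hr)
  subst hα
  have hβ : β = 0 := by
    refine smul_monic_add_eq_zero (hmonic n hn).1 (hmonic n hn).2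
      (r := γ • p (n - 1) + r) ?_ (by rw [← h, zero_smul]; abel)
    exact add_mem (Submodule.smul_mem _ _ (low (by omega))) (mono (by omega) hr)
  subst hβ
  refine ⟨rfl, fun h1 => ?_⟩
  exact smul_monic_add_eq_zero (hmonic (n - 1) (by omega)).1 (hmonic (n - 1) (by omega)).2
    hr (by rw [← h, zero_smul, zero_smul]; abel)

/-- The two lowest-order consequences of the compatibility of a three-term recurrence with a
strictly lower triangular evolution `∂ₜ p n = ∑ v (m - n) n • p m`. -/
lemma compatibility (hneg : ∀ m < 0, p m = 0)
    (hmonic : ∀ m, 0 ≤ m → (p m).Monic ∧ (p m).natDegree = m.toNat)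
    {L : R[X]} {k v : ℤ → ℤ → R} {q : ℤ → R[X]}
    (hrec : ∀ n, p n * L = k 1 n • p (n + 1) + k 0 n • p n + k (-1) n • p (n - 1))
    (hq : ∀ n, q n = v (-1) n • p (n - 1) + v (-2) n • p (n - 2) +
      ∑ m ∈ Finset.range (n - 2).toNat, v ((m : ℤ) - n) n • p m)
    {n : ℤ} (hn : 0 ≤ n) {D : ℤ → R}
    (hD : q n * L = D 1 • p (n + 1) + k 1 n • q (n + 1) + (D 0 • p n + k 0 n • q n) +
      (D (-1) • p (n - 1) + k (-1) n • q (n - 1))) :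
    D 0 = v (-1) n * k 1 (n - 1) - k 1 n * v (-1) (n + 1) ∧
    (1 ≤ n → D (-1) = v (-1) n * k 0 (n - 1) + v (-2) n * k 1 (n - 2) -
      k 1 n * v (-2) (n + 1) - k 0 n * v (-1) n) := by
  have low {m : ℤ} (hm : m < n - 1) : p m ∈ degreeLT R (n - 1).toNat :=
    mem_degreeLT_of_lt hneg hmonic hm
  have smul {c : R} {f : R[X]} (hf : f ∈ degreeLT R (n - 1).toNat) :
      c • f ∈ degreeLT R (n - 1).toNat := Submodule.smul_mem _ _ hf
  set rest : ℤ → R[X] := fun n =>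
    ∑ m ∈ Finset.range (n - 2).toNat, v ((m : ℤ) - n) n • p m with hrest
  have rest_mem {j : ℤ} (hj : j ≤ n + 1) : rest j ∈ degreeLT R (n - 1).toNat :=
    Submodule.sum_mem _ fun m hm => smul (low (by have := Finset.mem_range.1 hm; omega))
  have rest_mul_mem : rest n * L ∈ degreeLT R (n - 1).toNat := by
    rw [hrest, Finset.sum_mul]
    refine Submodule.sum_mem _ fun m hm => ?_
    have := Finset.mem_range.1 hm
    rw [smul_mul_assoc, hrec]
    exact smul (add_mem (add_mem (smul (low (by omega))) (smul (low (by omega))))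
      (smul (low (by omega))))
  have q_pred_mem : q (n - 1) ∈ degreeLT R (n - 1).toNat := by
    rw [hq]
    exact add_mem (add_mem (smul (low (by omega))) (smul (low (by omega))))
      (rest_mem (by omega))
  have hr : k 1 n • rest (n + 1) + k 0 n • (v (-2) n • p (n - 2) + rest n) +
      k (-1) n • q (n - 1) - v (-1) n • k (-1) (n - 1) • p (n - 2) -
      v (-2) n • (k 0 (n - 2) • p (n - 2) + k (-1) (n - 2) • p (n - 3)) - rest n * L ∈
      degreeLT R (n - 1).toNat := by
    refine sub_mem (sub_mem (sub_mem (add_mem (add_mem (smul (rest_mem le_rfl))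
      (smul (add_mem (smul (low (by omega))) (rest_mem (by omega))))) (smul q_pred_mem))
      (smul (smul (low (by omega))))) ?_) rest_mul_mem
    exact smul (add_mem (smul (low (by omega))) (smul (low (by omega))))
  have hcomb := eq_zero_of_three_term_combination hneg hmonic hn hr
    (α := D 1) (β := D 0 - (v (-1) n * k 1 (n - 1) - k 1 n * v (-1) (n + 1)))
    (γ := D (-1) - (v (-1) n * k 0 (n - 1) + v (-2) n * k 1 (n - 2) -
      k 1 n * v (-2) (n + 1) - k 0 n * v (-1) n)) ?_
  · exact ⟨sub_eq_zero.1 hcomb.1, fun h => sub_eq_zero.1 (hcomb.2 h)⟩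
  · have h1 := hrec (n - 1)
    have h2 := hrec (n - 2)
    rw [show n - 1 + 1 = n by ring, show n - 1 - 1 = n - 2 by ring] at h1
    rw [show n - 2 + 1 = n - 1 by ring, show n - 2 - 1 = n - 3 by ring] at h2
    have hqs := hq (n + 1)
    rw [show n + 1 - 1 = n by ring, show n + 1 - 2 = n - 1 by ring] at hqs
    have hrs : (∑ m ∈ Finset.range (n - 1).toNat, v ((m : ℤ) - (n + 1)) (n + 1) • p m) =
        rest (n + 1) := by
      simp only [hrest, show n + 1 - 2 = n - 1 by ring]
    rw [hrs] at hqs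
    have hqn : q n = v (-1) n • p (n - 1) + v (-2) n • p (n - 2) + rest n := hq n
    rw [hqs, hqn, add_mul, add_mul, smul_mul_assoc, smul_mul_assoc, h1, h2] at hD
    rw [← sub_eq_zero] at hD
    rw [← neg_eq_zero, ← hD]
    simp only [sub_smul, add_smul, smul_add, mul_smul]
    abel

end Algebra

section Evaluation

variable {N : ℕ}

lemma mEval_add (p q : Polynomial (Matrix (Fin N) (Fin N) ℂ)) (x : ℝ) :
    mEval (p + q) x = mEval p x + mEval q x := eval_add

lemma mEval_smul (c : Matrix (Fin N) (Fin N) ℂ) (p : Polynomial (Matrix (Fin N) (Fin N) ℂ))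
    (x : ℝ) : mEval (c • p) x = c * mEval p x := by
  simp [mEval, eval_smul]

lemma mEval_zero (x : ℝ) : mEval (0 : Polynomial (Matrix (Fin N) (Fin N) ℂ)) x = 0 := eval_zero

lemma mEval_mul (p q : Polynomial (Matrix (Fin N) (Fin N) ℂ)) (x : ℝ) :
    mEval (p * q) x = mEval p x * mEval q x :=
  eval₂_mul_noncomm _ _ fun _ => (Commute.one_right _).smul_right _

lemma mEval_sum {ι : Type*} (s : Finset ι)
    (f : ι → Polynomial (Matrix (Fin N) (Fin N) ℂ)) (x : ℝ) :
    mEval (∑ m ∈ s, f m) x = ∑ m ∈ s, mEval (f m) x := eval_finsetSum _ _ _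

/-- A matrix polynomial is determined by its values at real points. -/
lemma eq_of_mEval_eq {p q : Polynomial (Matrix (Fin N) (Fin N) ℂ)}
    (h : ∀ x, mEval p x = mEval q x) : p = q := by
  obtain ⟨A, rfl⟩ := matPolyEquiv.surjective p
  obtain ⟨B, rfl⟩ := matPolyEquiv.surjective q
  congr 1
  ext1 i j
  refine eq_of_infinite_eval_eq _ _ ((Set.infinite_range_of_injective
    Complex.ofReal_injective).mono ?_)
  rintro _ ⟨x, rfl⟩
  have hx := congrFun (congrFun (h x) i) j
  simpa only [Set.mem_ofPred_eq, mEval, smul_one_eq_diagonal, ← scalar_apply,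
    matPolyEquiv_eval] using hx

end Evaluation

lemma hasDerivAt_mul_apply {N : ℕ} {A B : ℝ → Matrix (Fin N) (Fin N) ℂ}
    {A' B' : Matrix (Fin N) (Fin N) ℂ} {t : ℝ}
    (hA : ∀ i j, HasDerivAt (fun s => A s i j) (A' i j) t)
    (hB : ∀ i j, HasDerivAt (fun s => B s i j) (B' i j) t) (i j : Fin N) :
    HasDerivAt (fun s => (A s * B s) i j) ((A' * B t + A t * B') i j) t := by
  simp only [Matrix.add_apply, Matrix.mul_apply, ← Finset.sum_add_distrib]
  exact HasDerivAt.fun_sum fun l _ => (hA i l).mul (hB l j)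

/-- Splitting off the two top terms of a sum over `0 ≤ m < n`, with the convention that terms
of negative index vanish. -/
lemma sum_range_toNat_eq {M : Type*} [AddCommGroup M] {f : ℤ → M} (hf : ∀ m < 0, f m = 0)
    (n : ℤ) : ∑ m ∈ Finset.range n.toNat, f m =
      f (n - 1) + f (n - 2) + ∑ m ∈ Finset.range (n - 2).toNat, f m := by
  rcases lt_or_ge n 2 with h | h
  · rw [show (n - 2).toNat = 0 by omega, hf (n - 2) (by omega)]
    rcases lt_or_ge n 1 with h' | h'
    · rw [show n.toNat = 0 by omega, hf (n - 1) (by omega)]; simp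
    · obtain rfl : n = 1 := by omega
      simp
  · obtain ⟨k, rfl⟩ : ∃ k : ℕ, n = k + 2 := ⟨(n - 2).toNat, by omega⟩
    rw [show ((k : ℤ) + 2).toNat = k + 2 by omega, show ((k : ℤ) + 2 - 2).toNat = k by omega,
      Finset.sum_range_succ, Finset.sum_range_succ, show (k : ℤ) + 2 - 1 = (k + 1 : ℕ) by
        push_cast; ring, show (k : ℤ) + 2 - 2 = k by ring]
    abel

end LangmuirLattice

/-- **Langmuir-type lattice equations.** In the setting of the evolution of the three-term
coefficients, if moreover `V_{-1}(n;t) = K_0(n;t)K_{-1}(n;t) + K_{-1}(n;t)K_0(n-1;t)` and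
`V_{-2}(n;t) = K_{-1}(n;t)K_{-1}(n-1;t)` (the coefficients of the square of the three-term
difference operator, corresponding to the deformation `v(x;t) = tx²`), then `K_0` and `K_{-1}`
satisfy the Langmuir-type lattice equations. -/
theorem langmuir_type_equations
    (N : ℕ) (hN : 1 ≤ N)
    (a b : ℝ) -- `t` ranges over the open interval `Set.Ioo a b`
    (Λ : Polynomial (Matrix (Fin N) (Fin N) ℂ))
    (hΛdeg : Λ.natDegree = 1)
    (P : ℤ → ℝ → Polynomial (Matrix (Fin N) (Fin N) ℂ))
    (hPneg : ∀ m : ℤ, m < 0 → ∀ t, P m t = 0)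
    (hPmonic : ∀ n : ℤ, 0 ≤ n → ∀ t ∈ Set.Ioo a b, (P n t).Monic ∧ (P n t).natDegree = n.toNat)
    (hPdiff : ∀ n : ℤ, ∀ d : ℕ, ∀ i j,
      DifferentiableOn ℝ (fun t => ((P n t).coeff d) i j) (Set.Ioo a b))
    (K : ℤ → ℤ → ℝ → Matrix (Fin N) (Fin N) ℂ)
    (hKzero : ∀ j n : ℤ, ∀ t : ℝ, (n < 0 ∨ n + j < 0) → K j n t = 0)
    (hKdiff : ∀ m n : ℤ, ∀ i j, DifferentiableOn ℝ (fun t => (K m n t) i j) (Set.Ioo a b))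
    (hKrel : ∀ n : ℤ, 0 ≤ n → ∀ t ∈ Set.Ioo a b, ∀ x : ℝ,
      mEval (P n t) x * mEval Λ x =
        K 1 n t * mEval (P (n + 1) t) x + K 0 n t * mEval (P n t) x +
          K (-1) n t * mEval (P (n - 1) t) x)
    (V : ℤ → ℤ → ℝ → Matrix (Fin N) (Fin N) ℂ)
    (hVzero : ∀ j n : ℤ, ∀ t : ℝ, (n < 0 ∨ n + j < 0) → V j n t = 0)
    (hVrel : ∀ n : ℤ, 0 ≤ n → ∀ t ∈ Set.Ioo a b, ∀ x : ℝ, ∀ i j,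
      HasDerivAt (fun s => (mEval (P n s) x) i j)
        ((∑ m ∈ Finset.range n.toNat, V ((m : ℤ) - n) n t * mEval (P (m : ℤ) t) x) i j) t)
    (hV1 : ∀ n : ℤ, ∀ t : ℝ,
      V (-1) n t = K 0 n t * K (-1) n t + K (-1) n t * K 0 (n - 1) t)
    (hV2 : ∀ n : ℤ, ∀ t : ℝ, V (-2) n t = K (-1) n t * K (-1) (n - 1) t) :
    ∀ n : ℤ, 0 ≤ n → ∀ t ∈ Set.Ioo a b, ∀ i j,
      HasDerivAt (fun s => (K 0 n s) i j)
        (((K 0 n t * K (-1) n t + K (-1) n t * K 0 (n - 1) t) * K 1 (n - 1) t -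
          K 1 n t * (K 0 (n + 1) t * K (-1) (n + 1) t + K (-1) (n + 1) t * K 0 n t)) i j) t ∧
      HasDerivAt (fun s => (K (-1) n s) i j)
        ((K (-1) n t * K (-1) (n - 1) t * K 1 (n - 2) t -
          K 1 n t * K (-1) (n + 1) t * K (-1) n t +
          K (-1) n t * (K 0 (n - 1) t) ^ 2 - (K 0 n t) ^ 2 * K (-1) n t) i j) t := by
  intro n hn t ht
  have hKpoly : ∀ n, P n t * Λ = K 1 n t • P (n + 1) t + K 0 n t • P n t +
      K (-1) n t • P (n - 1) t := by
    intro n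
    rcases lt_or_ge n 0 with h | h
    · simp [hPneg n h, hKzero _ n t (Or.inl h)]
    · refine LangmuirLattice.eq_of_mEval_eq fun x => ?_
      simpa only [LangmuirLattice.mEval_mul, LangmuirLattice.mEval_add,
        LangmuirLattice.mEval_smul] using hKrel n h t ht x
  let Q : ℤ → Polynomial (Matrix (Fin N) (Fin N) ℂ) := fun n =>
    ∑ m ∈ Finset.range n.toNat, V ((m : ℤ) - n) n t • P m t
  have hQ : ∀ n, Q n = V (-1) n t • P (n - 1) t + V (-2) n t • P (n - 2) t +
      ∑ m ∈ Finset.range (n - 2).toNat, V ((m : ℤ) - n) n t • P m t := by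
    intro n
    have := LangmuirLattice.sum_range_toNat_eq (f := fun m => V (m - n) n t • P m t)
      (fun m hm => by simp [hPneg m hm]) n
    simpa only [show n - 1 - n = -1 by ring, show n - 2 - n = -2 by ring] using this
  have hPderiv : ∀ n x i j,
      HasDerivAt (fun s => (mEval (P n s) x) i j) ((mEval (Q n) x) i j) t := by
    intro n x i j
    rcases lt_or_ge n 0 with h | h
    · simpa [Q, hPneg n h, LangmuirLattice.mEval_zero, show n.toNat = 0 by omega] using
        hasDerivAt_const t (0 : ℂ)
    · simpa only [Q, LangmuirLattice.mEval_sum, LangmuirLattice.mEval_smul] using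
        hVrel n h t ht x i j
  let D : ℤ → Matrix (Fin N) (Fin N) ℂ := fun m =>
    Matrix.of fun i j => deriv (fun s => K m n s i j) t
  have hKderiv : ∀ m i j, HasDerivAt (fun s => K m n s i j) (D m i j) t := fun m i j =>
    ((hKdiff m n i j).differentiableAt (isOpen_Ioo.mem_nhds ht)).hasDerivAt
  have hD : Q n * Λ = D 1 • P (n + 1) t + K 1 n t • Q (n + 1) +
      (D 0 • P n t + K 0 n t • Q n) + (D (-1) • P (n - 1) t + K (-1) n t • Q (n - 1)) := by
    refine LangmuirLattice.eq_of_mEval_eq fun x => ?_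
    simp only [LangmuirLattice.mEval_mul, LangmuirLattice.mEval_add, LangmuirLattice.mEval_smul]
    ext i j
    have hl := LangmuirLattice.hasDerivAt_mul_apply (hPderiv n x) (B := fun _ => mEval Λ x)
      (B' := 0) (fun i j => hasDerivAt_const t _) i j
    rw [mul_zero, add_zero] at hl
    have hr := ((LangmuirLattice.hasDerivAt_mul_apply (hKderiv 1) (hPderiv (n + 1) x) i j).add
      (LangmuirLattice.hasDerivAt_mul_apply (hKderiv 0) (hPderiv n x) i j)).add
      (LangmuirLattice.hasDerivAt_mul_apply (hKderiv (-1)) (hPderiv (n - 1) x) i j)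
    refine hl.unique (hr.congr_of_eventuallyEq ?_)
    filter_upwards [isOpen_Ioo.mem_nhds ht] with s hs
    exact congrFun (congrFun (hKrel n hn s hs x) i) j
  obtain ⟨h0, h1⟩ := LangmuirLattice.compatibility (p := fun n => P n t)
    (k := fun m n => K m n t) (v := fun m n => V m n t) (fun m hm => hPneg m hm t)
    (fun m hm => hPmonic m hm t ht) hKpoly hQ hn hD
  simp only [hV1, hV2, add_sub_cancel_right] at h0 h1
  intro i j
  refine ⟨(hKderiv 0 i j).congr_deriv (by rw [h0]), ?_⟩
  rcases lt_or_ge n 1 with h | h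
  · obtain rfl : n = 0 := by omega
    have hz : ∀ s, K (-1) 0 s = 0 := fun s => hKzero _ _ s (Or.inr (by norm_num))
    simpa [hz] using hasDerivAt_const t (0 : ℂ)
  · refine (hKderiv (-1) i j).congr_deriv (congrFun (congrFun ?_ i) j)
    rw [h1 h]
    simp only [pow_two, mul_add, add_mul, mul_assoc]
    abel
end

section
/- (Explicit verification of the Toda-type equations in the 2×2 Hermite example) Let a ∈ ℝ. For n ≥ 0 and t ∈ ℝ define the 2×2 matrices G_1 = −A with A = [[0,0],[a,0]], G_0(n;t) = [[2(na²+e^{−t})/(na²+2e^{−t}), 0],[0, ((n+1)a²+4e^{−t})/((n+1)a²+2e^{−t})]], and G_{−1}(n;t) = [[0, −2nae^{−t}/(na²+2e^{−t})²],[0, 0]]. Then for all t ∈ ℝ: (i) for all n ≥ 0, dG_0(n;t)/dt = G_{−1}(n;t)G_1 − G_1 G_{−1}(n+1;t); (ii) for all n ≥ 1, dG_{−1}(n;t)/dt = G_{−1}(n;t)G_0(n−1;t) − G_0(n;t)G_{−1}(n;t); (iii) dG_1/dt = 0. -/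
open Matrix

/-- The matrix `A = [[0,0],[a,0]]`. -/
noncomputable def Amat (a : ℝ) : Matrix (Fin 2) (Fin 2) ℂ :=
  !![(0 : ℂ), 0; (a : ℂ), 0]

/-- `G₁ = -A`. -/
noncomputable def G1 (a : ℝ) : Matrix (Fin 2) (Fin 2) ℂ := -Amat a

/-- `G₀(n;t) = [[2(na²+e^{-t})/(na²+2e^{-t}), 0],[0, ((n+1)a²+4e^{-t})/((n+1)a²+2e^{-t})]]`. -/
noncomputable def G0 (a : ℝ) (n : ℕ) (t : ℝ) : Matrix (Fin 2) (Fin 2) ℂ :=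
  !![((2 * ((n : ℝ) * a ^ 2 + Real.exp (-t)) / ((n : ℝ) * a ^ 2 + 2 * Real.exp (-t)) : ℝ) : ℂ), 0;
     0, (((((n : ℝ) + 1) * a ^ 2 + 4 * Real.exp (-t)) /
          (((n : ℝ) + 1) * a ^ 2 + 2 * Real.exp (-t)) : ℝ) : ℂ)]

/-- `G₋₁(n;t) = [[0, -2nae^{-t}/(na²+2e^{-t})²],[0, 0]]`. -/
noncomputable def Gm1 (a : ℝ) (n : ℕ) (t : ℝ) : Matrix (Fin 2) (Fin 2) ℂ :=
  !![0, ((-(2 * (n : ℝ) * a * Real.exp (-t)) /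
          ((n : ℝ) * a ^ 2 + 2 * Real.exp (-t)) ^ 2 : ℝ) : ℂ);
     0, 0]

/-- The derivative of `s ↦ (p + q e^{-s}) / (c + r e^{-s})`. -/
theorem hasDerivAt_exp_neg_div {p q c r t : ℝ} (h : c + r * Real.exp (-t) ≠ 0) :
    HasDerivAt (fun s => (p + q * Real.exp (-s)) / (c + r * Real.exp (-s)))
      ((p * r - q * c) * Real.exp (-t) / (c + r * Real.exp (-t)) ^ 2) t := by
  have he : HasDerivAt (fun s : ℝ => Real.exp (-s)) (-Real.exp (-t)) t := by
    simpa using (hasDerivAt_neg t).exp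
  refine (((he.const_mul q).const_add p).fun_div ((he.const_mul r).const_add c) h).congr_deriv ?_
  ring

/-- The derivative of `s ↦ q e^{-s} / (c + r e^{-s})²`. -/
theorem hasDerivAt_exp_neg_div_sq {q c r t : ℝ} (h : c + r * Real.exp (-t) ≠ 0) :
    HasDerivAt (fun s => q * Real.exp (-s) / (c + r * Real.exp (-s)) ^ 2)
      (q * Real.exp (-t) * (r * Real.exp (-t) - c) / (c + r * Real.exp (-t)) ^ 3) t := by
  have he : HasDerivAt (fun s : ℝ => Real.exp (-s)) (-Real.exp (-t)) t := by
    simpa using (hasDerivAt_neg t).exp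
  refine ((he.const_mul q).fun_div (((he.const_mul r).const_add c).fun_pow 2)
    (pow_ne_zero 2 h)).congr_deriv ?_
  clear he
  generalize Real.exp (-t) = e at h ⊢
  push_cast
  field_simp
  ring

/-- **Explicit verification of the Toda-type equations in the 2×2 Hermite example.**
The coefficients `G₁ = -A`, `G₀(n;t)` and `G₋₁(n;t)` of the three-term difference operator by
which the Casimir acts on the deformed `2×2` Hermite-type MVOPs satisfy the Toda-type lattice
equations for `k = 1`, entrywise in `t`. -/
theorem toda_equations_two_by_two_hermite (a : ℝ) :
    ∀ t : ℝ,
      (∀ n : ℕ, ∀ i j, HasDerivAt (fun s => (G0 a n s) i j)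
        ((Gm1 a n t * G1 a - G1 a * Gm1 a (n + 1) t) i j) t) ∧
      (∀ n : ℕ, 1 ≤ n → ∀ i j, HasDerivAt (fun s => (Gm1 a n s) i j)
        ((Gm1 a n t * G0 a (n - 1) t - G0 a n t * Gm1 a n t) i j) t) ∧
      (∀ i j, HasDerivAt (fun _ : ℝ => (G1 a) i j) 0 t) := by
  intro t
  have hpos (m : ℕ) : (m : ℝ) * a ^ 2 + 2 * Real.exp (-t) ≠ 0 := by positivity
  refine ⟨fun n i j => ?_, fun n hn i j => ?_, fun i j => hasDerivAt_const _ _⟩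
  · have h₁ := (hasDerivAt_exp_neg_div (p := 2 * (n * a ^ 2)) (q := 2) (hpos n)).ofReal_comp
    have h₂ := (hasDerivAt_exp_neg_div (p := (n + 1 : ℕ) * a ^ 2) (q := 4)
      (hpos (n + 1))).ofReal_comp
    fin_cases i <;> fin_cases j <;>
      simp only [G0, Gm1, G1, Amat, Matrix.sub_apply, Matrix.mul_apply, Fin.sum_univ_two,
        Matrix.neg_apply, Matrix.of_apply, Matrix.cons_val', Matrix.cons_val_zero,
        Matrix.cons_val_one, Matrix.cons_val_fin_one, Fin.zero_eta, Fin.mk_one]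
    · convert h₁ using 1
      · ext s
        ring_nf
      · push_cast
        ring
    · simpa using hasDerivAt_const t (0 : ℂ)
    · simpa using hasDerivAt_const t (0 : ℂ)
    · convert h₂ using 1
      · ext s
        push_cast
        rfl
      · push_cast
        ring
  · obtain ⟨m, rfl⟩ := Nat.exists_eq_add_of_le' hn
    have h := (hasDerivAt_exp_neg_div_sq (q := -(2 * (m + 1 : ℕ) * a)) (hpos (m + 1))).ofReal_comp
    fin_cases i <;> fin_cases j <;>
      simp only [G0, Gm1, Matrix.sub_apply, Matrix.mul_apply, Fin.sum_univ_two,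
        Matrix.of_apply, Matrix.cons_val', Matrix.cons_val_zero, Nat.add_sub_cancel,
        Matrix.cons_val_one, Matrix.cons_val_fin_one, Fin.zero_eta, Fin.mk_one]
    · simpa using hasDerivAt_const t (0 : ℂ)
    · convert h using 1
      · ext s
        ring_nf
      · have hm := hpos (m + 1)
        push_cast at hm
        simp only [mul_zero, zero_add, add_zero]
        norm_cast
        push_cast
        field_simp
        ring
    · simpa using hasDerivAt_const t (0 : ℂ)
    · simpa using hasDerivAt_const t (0 : ℂ)
end
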